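/- In the DoubleGreedy algorithm for maximizing a submodular continuous function f on [u, ū] with f(u) + f(ū) ≥ 0, where at each iteration the 1-D subproblems are solved with additive error at most δ ≥ 0, the intermediate solutions satisfy f(xⁱ) ≥ f(xⁱ⁻¹) − δ and f(yⁱ) ≥ f(yⁱ⁻¹) − δ for all iterations i. -/

import Mathlib

/-- `f` is submodular on `X`. -/
def SubmodularOn {n : ℕ} (f : (Fin n → ℝ) → ℝ) (X : Set (Fin n → ℝ)) : Prop :=
  ∀ x ∈ X, ∀ y ∈ X, f x + f y ≥ f (x ⊔ y) + f (x ⊓ y)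

/-- Submodular functions have decreasing differences: raising a coordinate gains at least as much
at a smaller point. -/
theorem SubmodularOn.update_add_update_le {n : ℕ} {f : (Fin n → ℝ) → ℝ} {u v x y : Fin n → ℝ}
    (hf : SubmodularOn f (Set.Icc u v)) (hux : u ≤ x) (hxy : x ≤ y) (hyv : y ≤ v)
    {j : Fin n} {a b : ℝ} (ha : u j ≤ a) (hab : a ≤ b) (hb : b ≤ v j) :
    f (Function.update y j b) + f (Function.update x j a) ≤
      f (Function.update y j a) + f (Function.update x j b) := by
  have hsup : Function.update y j a ⊔ Function.update x j b = Function.update y j b := by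
    ext k
    rcases eq_or_ne k j with rfl | hk
    · simpa using hab
    · simpa [hk] using hxy k
  have hinf : Function.update y j a ⊓ Function.update x j b = Function.update x j a := by
    ext k
    rcases eq_or_ne k j with rfl | hk
    · simpa using hab
    · simpa [hk] using hxy k
  have h := hf (Function.update y j a)
    ⟨le_update_iff.2 ⟨ha, fun k _ => (hux.trans hxy) k⟩,
      update_le_iff.2 ⟨hab.trans hb, fun k _ => hyv k⟩⟩
    (Function.update x j b)
    ⟨le_update_iff.2 ⟨ha.trans hab, fun k _ => hux k⟩,
      update_le_iff.2 ⟨hb, fun k _ => (hxy.trans hyv) k⟩⟩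
  rwa [hsup, hinf] at h

/-- If two sequences start at the corners `u ≤ v` and at step `i` both set coordinate `e i` to a
common value in `[u (e i), v (e i)]`, then they stay ordered inside the box, and the coordinates
not yet visited keep their initial values. -/
theorem coordinate_updates_invariant {n : ℕ} {u v : Fin n → ℝ} (huv : u ≤ v) {e : ℕ → Fin n}
    (he : ∀ i j, i < n → j < n → e i = e j → i = j) {x y : ℕ → Fin n → ℝ}
    (hx0 : x 0 = u) (hy0 : y 0 = v)
    (hstep : ∀ i < n, ∃ c ∈ Set.Icc (u (e i)) (v (e i)),
      x (i + 1) = Function.update (x i) (e i) c ∧ y (i + 1) = Function.update (y i) (e i) c)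
    {i : ℕ} (hi : i ≤ n) :
    u ≤ x i ∧ x i ≤ y i ∧ y i ≤ v ∧
      ∀ j, i ≤ j → j < n → x i (e j) = u (e j) ∧ y i (e j) = v (e j) := by
  induction i with
  | zero => simp [hx0, hy0, huv]
  | succ i ih =>
    obtain ⟨hux, hxy, hyv, hfresh⟩ := ih (by omega)
    obtain ⟨c, hc, hx, hy⟩ := hstep i hi
    rw [hx, hy]
    refine ⟨le_update_iff.2 ⟨hc.1, fun k _ => hux k⟩,
      update_le_update_iff.2 ⟨le_rfl, fun k _ => hxy k⟩,
      update_le_iff.2 ⟨hc.2, fun k _ => hyv k⟩, fun j hij hj => ?_⟩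
    have hne : e j ≠ e i := fun h => by
      have := he j i hj hi h
      omega
    simpa [hne] using hfresh j (by omega) hj

/-- In the `DoubleGreedy` algorithm for maximizing a submodular continuous function `f` on
the box `[u, ū]` with `f(u) + f(ū) ≥ 0`, where the 1-D subproblems are solved with additive
error at most `δ`, the objective values of both intermediate solutions decrease by at most
`δ` in each iteration: `f(xⁱ⁺¹) ≥ f(xⁱ) − δ` and `f(yⁱ⁺¹) ≥ f(yⁱ) − δ`. -/
theorem doubleGreedy_intermediate_values {n : ℕ} (u ubar : Fin n → ℝ) (huu : u ≤ ubar)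
    (f : (Fin n → ℝ) → ℝ)
    (hsub : SubmodularOn f (Set.Icc u ubar))
    (hnonneg : f u + f ubar ≥ 0)
    (δ : ℝ) (hδ : 0 ≤ δ)
    (e : ℕ → Fin n) (he : ∀ i j, i < n → j < n → e i = e j → i = j)
    (x y : ℕ → (Fin n → ℝ)) (ua ub : ℕ → ℝ)
    (hx0 : x 0 = u) (hy0 : y 0 = ubar)
    -- at step `i` the 1-D subproblems over coordinate `e i` are solved with error `≤ δ`:
    (hua_mem : ∀ i < n, ua i ∈ Set.Icc (u (e i)) (ubar (e i)))
    (hub_mem : ∀ i < n, ub i ∈ Set.Icc (u (e i)) (ubar (e i)))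
    (hua : ∀ i < n, ∀ c ∈ Set.Icc (u (e i)) (ubar (e i)),
      f (Function.update (x i) (e i) (ua i)) ≥ f (Function.update (x i) (e i) c) - δ)
    (hub : ∀ i < n, ∀ c ∈ Set.Icc (u (e i)) (ubar (e i)),
      f (Function.update (y i) (e i) (ub i)) ≥ f (Function.update (y i) (e i) c) - δ)
    -- the update rule, comparing the marginal gains `δₐ` and `δ_b`:
    (hupd : ∀ i < n,
      if f (Function.update (x i) (e i) (ua i)) - f (x i) ≥
          f (Function.update (y i) (e i) (ub i)) - f (y i) then
        x (i + 1) = Function.update (x i) (e i) (ua i) ∧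
          y (i + 1) = Function.update (y i) (e i) (ua i)
      else
        x (i + 1) = Function.update (x i) (e i) (ub i) ∧
          y (i + 1) = Function.update (y i) (e i) (ub i)) :
    ∀ i < n, f (x (i + 1)) ≥ f (x i) - δ ∧ f (y (i + 1)) ≥ f (y i) - δ := by
  have hstep : ∀ i < n, ∃ c ∈ Set.Icc (u (e i)) (ubar (e i)),
      x (i + 1) = Function.update (x i) (e i) c ∧
        y (i + 1) = Function.update (y i) (e i) c := by
    intro i hi
    have h := hupd i hi
    split_ifs at h
    · exact ⟨ua i, hua_mem i hi, h⟩
    · exact ⟨ub i, hub_mem i hi, h⟩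
  intro i hi
  obtain ⟨hux, hxy, hyv, hfresh⟩ :=
    coordinate_updates_invariant huu he hx0 hy0 hstep hi.le
  obtain ⟨hxi, hyi⟩ := hfresh i le_rfl hi
  have hx_eq : Function.update (x i) (e i) (u (e i)) = x i := by rw [← hxi]; simp
  have hy_eq : Function.update (y i) (e i) (ubar (e i)) = y i := by rw [← hyi]; simp
  have hlow : u (e i) ∈ Set.Icc (u (e i)) (ubar (e i)) := Set.left_mem_Icc.2 (huu _)
  have hhigh : ubar (e i) ∈ Set.Icc (u (e i)) (ubar (e i)) := Set.right_mem_Icc.2 (huu _)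
  have h := hupd i hi
  split_ifs at h
  · obtain ⟨hl, hr⟩ := hua_mem i hi
    have hdiff := hsub.update_add_update_le hux hxy hyv hl hr le_rfl
    have hgain := hua i hi _ hlow
    have hbest := hua i hi _ hhigh
    rw [hy_eq] at hdiff
    rw [hx_eq] at hgain
    rw [h.1, h.2]
    constructor <;> linarith
  · obtain ⟨hl, hr⟩ := hub_mem i hi
    have hdiff := hsub.update_add_update_le hux hxy hyv le_rfl hl hr
    have hgain := hub i hi _ hhigh
    have hbest := hub i hi _ hlow
    rw [hx_eq] at hdiff
    rw [hy_eq] at hgain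
    rw [h.1, h.2]
    constructor <;> linarith
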